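/- Iterated edge removal (content of the proposition on degrees of freedom of latent hierarchical structures): Let G = (B_G, C_G) be a pattern with m measured and n latent variables. Let S_1, …, S_p be pairwise disjoint sets of latent indices such that for each i: |S_i| ≥ 2; all indices in S_i have identical columns in B_G, identical columns in C_G, and identical rows in C_G (the latent variables indexed by S_i have the same set of parents and the same set of children); and the common number of children of S_i is at least |S_i|. Suppose further that the sets are sorted in reversed causal order: for i₁ < i₂, no latent index in S_{i₁} is an ancestor in G of any latent index in S_{i₂}, where j is an ancestor of i if there is a directed path from j to i along the edges encoded by C_G (equivalently, ((C_G)^l)_{i,j} ≠ 0 for some l ≥ 1 when C_G is viewed as a matrix of natural numbers). Then there exists a pattern G̃ with B̃_G ≤ B_G and C̃_G ≤ C_G entrywise, with |G̃| = |G| − Σ_{i=1}^{p} |S_i|(|S_i|−1)/2, such that M(G̃) = M(G); consequently dim(G) ≤ |G| + m − Σ_{i=1}^{p} |S_i|(|S_i|−1)/2. -/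

import Mathlib

open Matrix

noncomputable section

/-- A pattern (graph) `G` with `m` measured and `n` latent variables, given by a binary
matrix `B ∈ {0,1}^{m×n}` (edges from latents to measured variables) and a strictly upper
triangular binary matrix `C ∈ {0,1}^{n×n}` (edges among latents). -/
structure Pattern (m n : ℕ) where
  B : Matrix (Fin m) (Fin n) ℕ
  C : Matrix (Fin n) (Fin n) ℕ
  hB : ∀ i j, B i j ≤ 1
  hC : ∀ i j, C i j ≤ 1
  hCstrict : ∀ i j : Fin n, j ≤ i → C i j = 0

/-- The number of edges `|G|` of a pattern. -/
def Pattern.edges {m n : ℕ} (G : Pattern m n) : ℕ :=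
  (Finset.univ.filter fun p : Fin m × Fin n => G.B p.1 p.2 ≠ 0).card +
  (Finset.univ.filter fun p : Fin n × Fin n => G.C p.1 p.2 ≠ 0).card

/-- The distribution set `M(G)`: all covariance matrices
`Σ_X = B (I−C)⁻¹ Ω_L (I−C)⁻ᵀ Bᵀ + Ω_X` where `supp B ⊆ supp B_G`, `C` is strictly upper
triangular with `supp C ⊆ supp C_G`, and `Ω_X, Ω_L` are diagonal with positive entries. -/
def Pattern.distSet {m n : ℕ} (G : Pattern m n) : Set (Matrix (Fin m) (Fin m) ℝ) :=
  { Sx | ∃ (B : Matrix (Fin m) (Fin n) ℝ) (C : Matrix (Fin n) (Fin n) ℝ)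
        (dX : Fin m → ℝ) (dL : Fin n → ℝ),
      (∀ i j, G.B i j = 0 → B i j = 0) ∧
      (∀ i j : Fin n, j ≤ i → C i j = 0) ∧
      (∀ i j, G.C i j = 0 → C i j = 0) ∧
      (∀ i, 0 < dX i) ∧ (∀ i, 0 < dL i) ∧
      Sx = B * (1 - C)⁻¹ * Matrix.diagonal dL * ((1 - C)⁻¹)ᵀ * Bᵀ + Matrix.diagonal dX }

/-- The vanishing ideal `H(G)` of the distribution set `M(G)`: all real polynomials in the
`m²` matrix-entry variables vanishing at every element of `M(G)`. -/
def Pattern.vanishingIdeal {m n : ℕ} (G : Pattern m n) :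
    Ideal (MvPolynomial (Fin m × Fin m) ℝ) where
  carrier := { p | ∀ Sx ∈ G.distSet, MvPolynomial.eval (fun q => Sx q.1 q.2) p = 0 }
  add_mem' := by
    intro a b ha hb Sx hSx
    simp [ha Sx hSx, hb Sx hSx]
  zero_mem' := by
    intro Sx hSx
    simp
  smul_mem' := by
    intro c x hx Sx hSx
    simp [smul_eq_mul, hx Sx hSx]

/-- The model dimension `dim(G)`: the Krull dimension of the quotient of the real polynomial
ring in the `m²` matrix-entry variables by the vanishing ideal `H(G)`. -/
def Pattern.dim {m n : ℕ} (G : Pattern m n) : WithBot ℕ∞ :=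
  ringKrullDim (MvPolynomial (Fin m × Fin m) ℝ ⧸ G.vanishingIdeal)

/-- The number of children of latent index `j`: measured children (nonzero entries in column
`j` of `B_G`) plus latent children (nonzero entries in column `j` of `C_G`). -/
def Pattern.childCount {m n : ℕ} (G : Pattern m n) (j : Fin n) : ℕ :=
  (Finset.univ.filter fun i : Fin m => G.B i j ≠ 0).card +
  (Finset.univ.filter fun i : Fin n => G.C i j ≠ 0).card

/-- An integral extension does not raise the Krull dimension. -/
theorem ringKrullDim_le_of_isIntegral {A R : Type*} [CommRing A] [CommRing R] (f : A →+* R)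
    (hf : f.IsIntegral) : ringKrullDim R ≤ ringKrullDim A := by
  let _ : Algebra A R := f.toAlgebra
  have : Algebra.IsIntegral A R := ⟨hf⟩
  refine Order.krullDim_le_of_strictMono (PrimeSpectrum.comap f) fun I J hIJ => ?_
  have hIJ' : I.asIdeal < J.asIdeal := hIJ
  exact Ideal.IsIntegral.comap_lt_comap (R := A) hIJ'

/-- The Krull dimension of the image of a polynomial map is at most the number of parameters. -/
theorem ringKrullDim_quotient_ker_le {k ι σ : Type*} [Field k] [Finite ι] [Fintype σ]
    (φ : MvPolynomial ι k →ₐ[k] MvPolynomial σ k) :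
    ringKrullDim (MvPolynomial ι k ⧸ RingHom.ker φ) ≤ (Fintype.card σ : ℕ) := by
  have : IsDomain (MvPolynomial ι k ⧸ RingHom.ker φ) :=
    (Ideal.Quotient.isDomain_iff_prime _).2 (RingHom.ker_isPrime φ)
  obtain ⟨s, g, hg, hint⟩ := exists_integral_inj_algHom_of_fg k (MvPolynomial ι k ⧸ RingHom.ker φ)
  have hinj : Function.Injective ((Ideal.kerLiftAlg φ).comp g) :=
    (Ideal.kerLiftAlg_injective φ).comp hg
  have hs := lift_trdeg_le_of_injective _ hinj
  rw [MvPolynomial.trdeg_of_isDomain, MvPolynomial.trdeg_of_isDomain] at hs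
  have hs' : s ≤ Fintype.card σ := by simpa using hs
  calc ringKrullDim (MvPolynomial ι k ⧸ RingHom.ker φ)
      ≤ ringKrullDim (MvPolynomial (Fin s) k) := ringKrullDim_le_of_isIntegral g.toRingHom hint
    _ = (s : ℕ) := by simp [MvPolynomial.ringKrullDim_of_isNoetherianRing]
    _ ≤ (Fintype.card σ : ℕ) := by exact_mod_cast hs'

namespace Matrix

theorem det_one_sub_of_strictUpper {n : ℕ} {R : Type*} [CommRing R] {C : Matrix (Fin n) (Fin n) R}
    (hC : ∀ i j : Fin n, j ≤ i → C i j = 0) : (1 - C).det = 1 := by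
  rw [det_of_isUpperTriangular]
  · exact Finset.prod_eq_one fun i _ => by simp [hC i i le_rfl]
  · intro i j hij
    have hij' : j < i := hij
    simp [hC i j hij'.le, one_apply_ne hij'.ne']

theorem inv_one_sub_of_strictUpper {n : ℕ} {R : Type*} [CommRing R] {C : Matrix (Fin n) (Fin n) R}
    (hC : ∀ i j : Fin n, j ≤ i → C i j = 0) : (1 - C)⁻¹ = (1 - C).adjugate := by
  simp [inv_def, det_one_sub_of_strictUpper hC]

end Matrix

namespace Pattern

variable {m n : ℕ}

theorem C_diag (G : Pattern m n) (i : Fin n) : G.C i i = 0 := G.hCstrict i i le_rfl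

/-- The latent noise variances can be normalized to one. -/
theorem mem_distSet_iff (G : Pattern m n) (Sx : Matrix (Fin m) (Fin m) ℝ) :
    Sx ∈ G.distSet ↔ ∃ (B : Matrix (Fin m) (Fin n) ℝ) (C : Matrix (Fin n) (Fin n) ℝ)
        (dX : Fin m → ℝ), (∀ i j, G.B i j = 0 → B i j = 0) ∧ (∀ i j, G.C i j = 0 → C i j = 0) ∧
      (∀ i, 0 < dX i) ∧ Sx = B * (1 - C)⁻¹ * ((1 - C)⁻¹)ᵀ * Bᵀ + diagonal dX := by
  constructor
  · rintro ⟨B, C, dX, dL, hB, hstrict, hC, hX, hL, rfl⟩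
    set e : Fin n → ℝ := fun i => √(dL i)
    have hepos : ∀ i, 0 < e i := fun i => Real.sqrt_pos.2 (hL i)
    have hee : diagonal e * diagonal e = diagonal dL := by
      rw [diagonal_mul_diagonal]; congr 1; ext i; exact Real.mul_self_sqrt (hL i).le
    have h1 : diagonal e * diagonal e⁻¹ = 1 := by
      rw [diagonal_mul_diagonal, ← diagonal_one]; congr 1; ext i
      exact mul_inv_cancel₀ (hepos i).ne'
    have h2 : diagonal e⁻¹ * diagonal e = 1 := by
      rw [diagonal_mul_diagonal, ← diagonal_one]; congr 1; ext i
      exact inv_mul_cancel₀ (hepos i).ne'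
    have hi1 : (diagonal e)⁻¹ = diagonal e⁻¹ := inv_eq_left_inv h2
    have hi2 : (diagonal e⁻¹)⁻¹ = diagonal e := inv_eq_left_inv h1
    refine ⟨B * diagonal e, diagonal e⁻¹ * C * diagonal e, dX, ?_, ?_, hX, ?_⟩
    · intro i j h; simp [hB i j h]
    · intro i j h; simp [hC i j h]
    · have hinv : (1 - diagonal e⁻¹ * C * diagonal e)⁻¹
          = diagonal e⁻¹ * (1 - C)⁻¹ * diagonal e := by
        have : 1 - diagonal e⁻¹ * C * diagonal e = diagonal e⁻¹ * (1 - C) * diagonal e := by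
          rw [mul_sub, sub_mul, mul_one, h2]
        rw [this, Matrix.mul_inv_rev, Matrix.mul_inv_rev, hi1, hi2, Matrix.mul_assoc]
      have hBC : B * diagonal e * (1 - diagonal e⁻¹ * C * diagonal e)⁻¹
          = B * (1 - C)⁻¹ * diagonal e := by
        rw [hinv, ← Matrix.mul_assoc, ← Matrix.mul_assoc, Matrix.mul_assoc B, h1, Matrix.mul_one]
      congr 1
      rw [Matrix.mul_assoc _ _ (B * diagonal e)ᵀ, ← transpose_mul, hBC, transpose_mul, transpose_mul,
        diagonal_transpose, ← hee]
      simp only [Matrix.mul_assoc]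
  · rintro ⟨B, C, dX, hB, hC, hX, rfl⟩
    exact ⟨B, C, dX, 1, hB, fun i j h => hC i j (G.hCstrict i j h), hC, hX, fun _ => one_pos,
      by simp⟩

theorem distSet_mono {G H : Pattern m n} (hB : ∀ i j, G.B i j ≤ H.B i j)
    (hC : ∀ i j, G.C i j ≤ H.C i j) : G.distSet ⊆ H.distSet := by
  rintro _ ⟨B, C, dX, dL, h1, h2, h3, h4, h5, rfl⟩
  exact ⟨B, C, dX, dL, fun i j h => h1 i j (Nat.le_zero.1 (h ▸ hB i j)), h2,
    fun i j h => h3 i j (Nat.le_zero.1 (h ▸ hC i j)), h4, h5, rfl⟩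

/-- Free parameters of the model with unit latent noise: edge weights and measured noise
variances. -/
abbrev Param (G : Pattern m n) : Type :=
  ({q : Fin m × Fin n // G.B q.1 q.2 ≠ 0} ⊕ {q : Fin n × Fin n // G.C q.1 q.2 ≠ 0}) ⊕ Fin m

theorem card_param (G : Pattern m n) : Fintype.card G.Param = G.edges + m := by
  simp [Param, edges, Fintype.card_subtype]

/-- The generic measured loading matrix. -/
def genB (G : Pattern m n) : Matrix (Fin m) (Fin n) (MvPolynomial G.Param ℝ) :=
  of fun i j => if h : G.B i j ≠ 0 then MvPolynomial.X (.inl (.inl ⟨(i, j), h⟩)) else 0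

/-- The generic latent coefficient matrix. -/
def genC (G : Pattern m n) : Matrix (Fin n) (Fin n) (MvPolynomial G.Param ℝ) :=
  of fun i j => if h : G.C i j ≠ 0 then MvPolynomial.X (.inl (.inr ⟨(i, j), h⟩)) else 0

/-- The generic covariance matrix with unit latent noise. -/
def genCov (G : Pattern m n) : Matrix (Fin m) (Fin m) (MvPolynomial G.Param ℝ) :=
  G.genB * (1 - G.genC).adjugate * ((1 - G.genC).adjugate)ᵀ * G.genBᵀ +
    diagonal fun i => MvPolynomial.X (.inr i)

theorem dim_le (G : Pattern m n) : G.dim ≤ (G.edges + m : ℕ) := by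
  set φ : MvPolynomial (Fin m × Fin m) ℝ →ₐ[ℝ] MvPolynomial G.Param ℝ :=
    MvPolynomial.aeval fun q => G.genCov q.1 q.2 with hφ
  have hker : RingHom.ker φ ≤ G.vanishingIdeal := by
    intro f hf Sx hSx
    obtain ⟨B, C, dX, hB, hC, -, rfl⟩ := (G.mem_distSet_iff Sx).1 hSx
    let v : G.Param → ℝ := Sum.elim (Sum.elim (fun q => B q.1.1 q.1.2) fun q => C q.1.1 q.1.2) dX
    have hvB : G.genB.map (MvPolynomial.eval v) = B := by
      ext i j
      by_cases h : G.B i j = 0 <;> simp [genB, h, v, hB i j]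
    have hvC : G.genC.map (MvPolynomial.eval v) = C := by
      ext i j
      by_cases h : G.C i j = 0 <;> simp [genC, h, v, hC i j]
    have hadj : (1 - G.genC).adjugate.map (MvPolynomial.eval v) = (1 - C)⁻¹ := by
      rw [inv_one_sub_of_strictUpper fun i j h => hC i j (G.hCstrict i j h), ← hvC,
        ← RingHom.mapMatrix_apply, RingHom.map_adjugate, map_sub, map_one,
        RingHom.mapMatrix_apply]
    have hcov : G.genCov.map (MvPolynomial.eval v) =
        B * (1 - C)⁻¹ * ((1 - C)⁻¹)ᵀ * Bᵀ + diagonal dX := by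
      rw [genCov, Matrix.map_add _ (map_add _), Matrix.map_mul, Matrix.map_mul, Matrix.map_mul,
        transpose_map, transpose_map, hvB, hadj, diagonal_map (map_zero _)]
      simp [v]
    have h0 : MvPolynomial.eval v (φ f) = 0 := by
      rw [RingHom.mem_ker.1 hf, map_zero]
    rw [← hcov]
    rw [hφ, MvPolynomial.aeval_def, MvPolynomial.hom_eval₂] at h0
    rw [← h0, MvPolynomial.eval, MvPolynomial.coe_eval₂Hom]
    congr 1
    ext x
    simp
  refine (ringKrullDim_le_of_surjective (Ideal.Quotient.factor hker)
    (Ideal.Quotient.factor_surjective hker)).trans ?_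
  rw [← card_param]
  exact ringKrullDim_quotient_ker_le φ

end Pattern

namespace Matrix

/-- A row-wise orthogonal triangularization acting only on the coordinates in `S`. -/
theorem exists_orthogonal_triangularizing {n : ℕ} (S : Finset (Fin n)) (A : S → Fin n → ℝ) :
    ∃ Q : Matrix (Fin n) (Fin n) ℝ, Q * Qᵀ = 1 ∧ (∀ i ∉ S, ∀ k ≠ i, Q i k = 0) ∧
      (∀ i ∉ S, Q i i = 1) ∧ (∀ i ∈ S, ∀ k ∉ S, Q i k = 0) ∧
      ∀ s t : S, s < t → ∑ k, A s k * Q t k = 0 := by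
  let b := InnerProductSpace.gramSchmidtOrthonormalBasis (𝕜 := ℝ)
    (finrank_euclideanSpace (𝕜 := ℝ) (ι := S))
    fun s => WithLp.toLp 2 fun k : S => A s k
  let Q₀ : Matrix S S ℝ := of fun s k => b s k
  have hQ₀ : Q₀ * Q₀ᵀ = 1 := by
    ext s t
    have := (orthonormal_iff_ite.1 b.orthonormal) t s
    rw [PiLp.inner_apply] at this
    simpa [Q₀, mul_apply, one_apply, eq_comm] using this
  let e : S ⊕ {x // x ∉ S} ≃ Fin n := Equiv.sumCompl (· ∈ S)
  let Q : Matrix (Fin n) (Fin n) ℝ := (fromBlocks Q₀ 0 0 1).submatrix e.symm e.symm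
  have he : ∀ i (hi : i ∈ S), e.symm i = .inl ⟨i, hi⟩ := fun i hi =>
    Equiv.sumCompl_symm_apply_of_pos hi
  have he' : ∀ i (hi : i ∉ S), e.symm i = .inr ⟨i, hi⟩ := fun i hi =>
    Equiv.sumCompl_symm_apply_of_neg hi
  have hQ : ∀ i ∈ S, ∀ k ∉ S, Q i k = 0 := fun i hi k hk => by simp [Q, he i hi, he' k hk]
  refine ⟨Q, ?_, fun i hi k hk => ?_, fun i hi => by simp [Q, he' i hi], hQ, fun s t hst => ?_⟩
  · rw [transpose_submatrix, submatrix_mul_equiv, fromBlocks_transpose, fromBlocks_multiply]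
    simp [hQ₀]
  · by_cases hkS : k ∈ S
    · simp [Q, he' i hi, he k hkS]
    · simp [Q, he' i hi, he' k hkS, hk.symm]
  · have h0 := InnerProductSpace.gramSchmidtOrthonormalBasis_inv_triangular (𝕜 := ℝ)
      (finrank_euclideanSpace (𝕜 := ℝ) (ι := S))
      (fun s => WithLp.toLp 2 fun k : S => A s k) hst
    rw [PiLp.inner_apply] at h0
    rw [← Finset.sum_subset (Finset.subset_univ S) fun k _ hk => by rw [hQ t t.2 k hk, mul_zero],
      ← Finset.sum_coe_sort, ← h0]
    refine Finset.sum_congr rfl fun k _ => ?_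
    simp [Q, he _ t.2, he _ k.2, Q₀, b]

/-- Conjugation by an orthogonal matrix leaves the latent part of the covariance unchanged. -/
theorem latentCov_conj_orthogonal {m n : ℕ} (B : Matrix (Fin m) (Fin n) ℝ)
    (C Q : Matrix (Fin n) (Fin n) ℝ) (hQ : Q * Qᵀ = 1) :
    B * Qᵀ * (1 - Q * C * Qᵀ)⁻¹ * ((1 - Q * C * Qᵀ)⁻¹)ᵀ * (B * Qᵀ)ᵀ =
      B * (1 - C)⁻¹ * ((1 - C)⁻¹)ᵀ * Bᵀ := by
  have hQ' : Qᵀ * Q = 1 := mul_eq_one_comm.1 hQ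
  have hinv : (1 - Q * C * Qᵀ)⁻¹ = Q * (1 - C)⁻¹ * Qᵀ := by
    have : 1 - Q * C * Qᵀ = Q * (1 - C) * Qᵀ := by rw [mul_sub, sub_mul, mul_one, hQ]
    rw [this, Matrix.mul_inv_rev, Matrix.mul_inv_rev, inv_eq_left_inv hQ, inv_eq_left_inv hQ',
      Matrix.mul_assoc]
  have h : B * Qᵀ * (1 - Q * C * Qᵀ)⁻¹ = B * (1 - C)⁻¹ * Qᵀ := by
    rw [hinv, ← Matrix.mul_assoc, ← Matrix.mul_assoc, Matrix.mul_assoc B, hQ', Matrix.mul_one]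
  rw [Matrix.mul_assoc _ _ (B * Qᵀ)ᵀ, ← transpose_mul, h, Matrix.mul_assoc (B * (1 - C)⁻¹) _ Bᵀ,
    ← transpose_mul, transpose_mul _ Qᵀ, transpose_transpose, ← Matrix.mul_assoc,
    Matrix.mul_assoc _ Qᵀ, hQ', Matrix.mul_one]

end Matrix

/-- The number of strictly increasing pairs in a finite linear order. -/
theorem card_filter_lt_pairs (α : Type*) [Fintype α] [LinearOrder α] :
    (Finset.univ.filter fun q : α × α => q.1 < q.2).card =
      Fintype.card α * (Fintype.card α - 1) / 2 := by
  have hswap : (Finset.univ.filter fun q : α × α => q.2 < q.1).card =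
      (Finset.univ.filter fun q : α × α => q.1 < q.2).card :=
    Finset.card_equiv (Equiv.prodComm α α) (by simp)
  have hoff : (Finset.univ.filter fun q : α × α => q.1 < q.2) ∪
      (Finset.univ.filter fun q : α × α => q.2 < q.1) = (Finset.univ : Finset α).offDiag := by
    ext q
    simp [lt_or_lt_iff_ne]
  have hd : Disjoint (Finset.univ.filter fun q : α × α => q.1 < q.2)
      (Finset.univ.filter fun q : α × α => q.2 < q.1) :=
    Finset.disjoint_filter.2 fun q _ h => h.asymm
  have h := congrArg Finset.card hoff
  rw [Finset.card_union_of_disjoint hd, hswap, Finset.offDiag_card, Finset.card_univ] at h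
  rw [Nat.mul_sub_one]
  lia

namespace Pattern

variable {m n : ℕ}

/-- All edges of a pattern, measured and latent children together. -/
def adj (G : Pattern m n) : Fin m ⊕ Fin n → Fin n → ℕ := Sum.elim G.B G.C

theorem edges_eq_card_adj (G : Pattern m n) :
    G.edges = (Finset.univ.filter fun q : (Fin m ⊕ Fin n) × Fin n => G.adj q.1 q.2 ≠ 0).card := by
  rw [edges, Finset.card_filter, Finset.card_filter, Finset.card_filter, Fintype.sum_prod_type,
    Fintype.sum_prod_type, Fintype.sum_prod_type, Fintype.sum_sum_type]
  rfl

theorem childCount_eq_card_adj (G : Pattern m n) (j : Fin n) :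
    G.childCount j = (Finset.univ.filter fun x => G.adj x j ≠ 0).card := by
  rw [childCount, Finset.card_filter, Finset.card_filter, Finset.card_filter,
    Fintype.sum_sum_type]
  rfl

/-- Removal of a set of edges. -/
def erase (G : Pattern m n) (R : Finset ((Fin m ⊕ Fin n) × Fin n)) : Pattern m n where
  B := of fun i j => if (.inl i, j) ∈ R then 0 else G.B i j
  C := of fun i j => if (.inr i, j) ∈ R then 0 else G.C i j
  hB i j := by have := G.hB i j; simp only [of_apply]; split <;> lia
  hC i j := by have := G.hC i j; simp only [of_apply]; split <;> lia
  hCstrict i j h := by simp [G.hCstrict i j h]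

theorem erase_B_le (G : Pattern m n) (R : Finset ((Fin m ⊕ Fin n) × Fin n)) (i : Fin m)
    (j : Fin n) : (G.erase R).B i j ≤ G.B i j := by
  simp only [erase, of_apply]; split <;> lia

theorem erase_C_le (G : Pattern m n) (R : Finset ((Fin m ⊕ Fin n) × Fin n)) (i : Fin n)
    (j : Fin n) : (G.erase R).C i j ≤ G.C i j := by
  simp only [erase, of_apply]; split <;> lia

theorem adj_erase (G : Pattern m n) (R : Finset ((Fin m ⊕ Fin n) × Fin n)) (x : Fin m ⊕ Fin n)
    (j : Fin n) : (G.erase R).adj x j = if (x, j) ∈ R then 0 else G.adj x j := by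
  cases x <;> rfl

theorem edges_erase_add_card (G : Pattern m n) {R : Finset ((Fin m ⊕ Fin n) × Fin n)}
    (hR : ∀ q ∈ R, G.adj q.1 q.2 ≠ 0) : (G.erase R).edges + R.card = G.edges := by
  rw [edges_eq_card_adj, edges_eq_card_adj]
  have h : (Finset.univ.filter fun q : (Fin m ⊕ Fin n) × Fin n => (G.erase R).adj q.1 q.2 ≠ 0) =
      (Finset.univ.filter fun q : (Fin m ⊕ Fin n) × Fin n => G.adj q.1 q.2 ≠ 0) \ R := by
    ext q
    simp [adj_erase, and_comm]
  rw [h]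
  exact Finset.card_sdiff_add_card_eq_card fun q hq => by simpa using hR q hq

/-- Latent variables with the same parents and the same children can be rotated so that the
loadings of `|S|` of the children become triangular. -/
theorem exists_edges_removable (G : Pattern m n) (S : Finset (Fin n)) (hne : S.Nonempty)
    (hBcols : ∀ j₁ ∈ S, ∀ j₂ ∈ S, ∀ r, G.B r j₁ = G.B r j₂)
    (hCcols : ∀ j₁ ∈ S, ∀ j₂ ∈ S, ∀ r, G.C r j₁ = G.C r j₂)
    (hCrows : ∀ j₁ ∈ S, ∀ j₂ ∈ S, ∀ r, G.C j₁ r = G.C j₂ r)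
    (hchild : ∀ j ∈ S, S.card ≤ G.childCount j) :
    ∃ R : Finset ((Fin m ⊕ Fin n) × Fin n), (∀ q ∈ R, G.adj q.1 q.2 ≠ 0) ∧ (∀ q ∈ R, q.2 ∈ S) ∧
      R.card = S.card * (S.card - 1) / 2 ∧ (G.erase R).distSet = G.distSet := by
  obtain ⟨j₀, hj₀⟩ := hne
  have hadj : ∀ j₁ ∈ S, ∀ j₂ ∈ S, ∀ x, G.adj x j₁ = G.adj x j₂ := by
    rintro j₁ h₁ j₂ h₂ (i | i)
    exacts [hBcols j₁ h₁ j₂ h₂ i, hCcols j₁ h₁ j₂ h₂ i]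
  have hcard : Fintype.card S ≤ Fintype.card {x // G.adj x j₀ ≠ 0} := by
    rw [Fintype.card_coe, Fintype.card_subtype, ← childCount_eq_card_adj]
    exact hchild j₀ hj₀
  obtain ⟨r⟩ := Function.Embedding.nonempty_of_card_le hcard
  let f : S × S ↪ (Fin m ⊕ Fin n) × Fin n :=
    (r.trans (Function.Embedding.subtype _)).prodMap (Function.Embedding.subtype _)
  let R := (Finset.univ.filter fun q : S × S => q.1 < q.2).map f
  have hR : ∀ x j, (x, j) ∈ R ↔ ∃ s t : S, s < t ∧ (r s : Fin m ⊕ Fin n) = x ∧ (t : Fin n) = j := by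
    intro x j
    simp [R, f, Prod.map]
  refine ⟨R, ?_, ?_, ?_, ?_⟩
  · rintro ⟨x, j⟩ hq
    obtain ⟨s, t, -, rfl, rfl⟩ := (hR x j).1 hq
    exact hadj j₀ hj₀ t t.2 _ ▸ (r s).2
  · rintro ⟨x, j⟩ hq
    obtain ⟨s, t, -, rfl, rfl⟩ := (hR x j).1 hq
    exact t.2
  · rw [Finset.card_map, card_filter_lt_pairs, Fintype.card_coe]
  · refine (distSet_mono (G.erase_B_le R) (G.erase_C_le R)).antisymm fun Sx hSx => ?_
    obtain ⟨B, C, dX, hB, hC, hX, rfl⟩ := (G.mem_distSet_iff Sx).1 hSx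
    let M : Fin m ⊕ Fin n → Fin n → ℝ := Sum.elim B C
    have hM : ∀ x j, G.adj x j = 0 → M x j = 0 := by
      rintro (i | i) j h
      exacts [hB i j h, hC i j h]
    obtain ⟨Q, hQ, hQoff, hQone, hQS, htri⟩ :=
      exists_orthogonal_triangularizing S fun s => M (r s)
    have hzero : ∀ x j, G.adj x j = 0 → ∑ k, M x k * Q j k = 0 := by
      intro x j h
      refine Finset.sum_eq_zero fun k _ => ?_
      by_cases hj : j ∈ S
      · by_cases hk : k ∈ S
        · rw [hM x k (hadj j hj k hk x ▸ h), zero_mul]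
        · rw [hQS j hj k hk, mul_zero]
      · by_cases hkj : k = j
        · rw [hkj, hM x j h, zero_mul]
        · rw [hQoff j hj k hkj, mul_zero]
    have hzeroR : ∀ x j, (x, j) ∈ R → ∑ k, M x k * Q j k = 0 := by
      intro x j h
      obtain ⟨s, t, hst, rfl, rfl⟩ := (hR x j).1 h
      exact htri s t hst
    have hCQ : ∀ i j, (Q * C * Qᵀ) i j = ∑ l, Q i l * ∑ k, M (.inr l) k * Q j k := by
      intro i j
      rw [Matrix.mul_assoc, mul_apply]
      rfl
    rw [mem_distSet_iff]
    refine ⟨B * Qᵀ, Q * C * Qᵀ, dX, ?_, ?_, hX, by rw [latentCov_conj_orthogonal B C Q hQ]⟩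
    · intro i j h
      change ∑ k, M (.inl i) k * Q j k = 0
      by_cases hij : (.inl i, j) ∈ R
      · exact hzeroR _ _ hij
      · exact hzero _ _ (show G.B i j = 0 by simpa [erase, hij] using h)
    · intro i j h
      rw [hCQ]
      refine Finset.sum_eq_zero fun l _ => ?_
      by_cases hi : i ∈ S
      · by_cases hl : l ∈ S
        · have hij : (.inr i, j) ∉ R := by
            intro hij
            obtain ⟨s, t, -, hs, rfl⟩ := (hR _ j).1 hij
            have h1 : G.adj (.inr i) j₀ ≠ 0 := hs ▸ (r s).2
            exact h1 ((hCrows i hi j₀ hj₀ j₀).trans (G.C_diag j₀))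
          have h1 : G.C i j = 0 := by simpa [erase, hij] using h
          rw [hzero (.inr l) j ((hCrows l hl i hi j).trans h1), mul_zero]
        · rw [hQS i hi l hl, zero_mul]
      · by_cases hli : l = i
        · subst hli
          by_cases hij : (.inr l, j) ∈ R
          · rw [hzeroR _ _ hij, mul_zero]
          · rw [hzero (.inr l) j (show G.C l j = 0 by simpa [erase, hij] using h), mul_zero]
        · rw [hQoff i hi l hli, zero_mul]

/-- Edges can be removed from all the sets `S i`, in order, without changing the distribution
set; only edges out of these sets are affected. -/
theorem exists_iterated_removal {p : ℕ} (G : Pattern m n) (S : Fin p → Finset (Fin n))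
    (hdisj : ∀ i₁ i₂ : Fin p, i₁ ≠ i₂ → Disjoint (S i₁) (S i₂))
    (hne : ∀ i : Fin p, (S i).Nonempty)
    (hBcols : ∀ i : Fin p, ∀ j₁ ∈ S i, ∀ j₂ ∈ S i, ∀ r : Fin m, G.B r j₁ = G.B r j₂)
    (hCcols : ∀ i : Fin p, ∀ j₁ ∈ S i, ∀ j₂ ∈ S i, ∀ r : Fin n, G.C r j₁ = G.C r j₂)
    (hCrows : ∀ i : Fin p, ∀ j₁ ∈ S i, ∀ j₂ ∈ S i, ∀ r : Fin n, G.C j₁ r = G.C j₂ r)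
    (hchild : ∀ i : Fin p, ∀ j ∈ S i, (S i).card ≤ G.childCount j)
    (horder : ∀ i₁ i₂ : Fin p, i₁ < i₂ → ∀ j ∈ S i₁, ∀ i ∈ S i₂, G.C i j = 0) :
    ∃ Gt : Pattern m n,
      (∀ i j, Gt.B i j ≤ G.B i j) ∧ (∀ i j, Gt.C i j ≤ G.C i j) ∧
      (∀ j, (∀ i, j ∉ S i) → ∀ x, Gt.adj x j = G.adj x j) ∧
      Gt.edges + ∑ i : Fin p, (S i).card * ((S i).card - 1) / 2 = G.edges ∧
      Gt.distSet = G.distSet := by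
  induction p with
  | zero => exact ⟨G, fun _ _ => le_rfl, fun _ _ => le_rfl, fun _ _ _ => rfl, by simp, rfl⟩
  | succ p ih =>
    obtain ⟨H, hHB, hHC, hHadj, hHedges, hHdist⟩ := ih (fun i => S i.castSucc)
      (fun i₁ i₂ h => hdisj _ _ fun h' => h (Fin.castSucc_injective p h'))
      (fun i => hne _) (fun i => hBcols _) (fun i => hCcols _) (fun i => hCrows _)
      (fun i => hchild _) fun i₁ i₂ h => horder _ _ h
    set T := S (Fin.last p)
    have hTcol : ∀ j ∈ T, ∀ x, H.adj x j = G.adj x j := fun j hj => hHadj j fun i hi =>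
      Finset.disjoint_left.1 (hdisj _ _ (Fin.castSucc_lt_last i).ne) hi hj
    have hTrow : ∀ i ∈ T, ∀ j, H.C i j = G.C i j := by
      intro i hi j
      by_cases h : ∃ k : Fin p, j ∈ S k.castSucc
      · obtain ⟨k, hk⟩ := h
        have h0 := horder _ _ (Fin.castSucc_lt_last k) j hk i hi
        have := hHC i j
        lia
      · exact hHadj j (not_exists.1 h) (.inr i)
    obtain ⟨R, hRadj, hRT, hRcard, hRdist⟩ := H.exists_edges_removable T (hne _)
      (fun j₁ h₁ j₂ h₂ i => (hTcol j₁ h₁ (.inl i)).trans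
        ((hBcols _ j₁ h₁ j₂ h₂ i).trans (hTcol j₂ h₂ (.inl i)).symm))
      (fun j₁ h₁ j₂ h₂ i => (hTcol j₁ h₁ (.inr i)).trans
        ((hCcols _ j₁ h₁ j₂ h₂ i).trans (hTcol j₂ h₂ (.inr i)).symm))
      (fun j₁ h₁ j₂ h₂ i => by rw [hTrow j₁ h₁, hTrow j₂ h₂, hCrows _ j₁ h₁ j₂ h₂])
      (fun j hj => by
        have h := hchild _ j hj
        rw [childCount_eq_card_adj] at h ⊢
        simpa only [hTcol j hj] using h)
    refine ⟨H.erase R, fun i j => (H.erase_B_le R i j).trans (hHB i j),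
      fun i j => (H.erase_C_le R i j).trans (hHC i j), fun j hj x => ?_, ?_, hRdist.trans hHdist⟩
    · rw [adj_erase, if_neg fun h => hj _ (hRT _ h), hHadj j fun i => hj _]
    · have := H.edges_erase_add_card hRadj
      rw [Fin.sum_univ_castSucc, ← hHedges, ← this, hRcard]
      ring

theorem dim_eq_of_distSet_eq {G H : Pattern m n} (h : G.distSet = H.distSet) : G.dim = H.dim := by
  have : G.vanishingIdeal = H.vanishingIdeal := by
    ext f
    change (∀ Sx ∈ G.distSet, _) ↔ ∀ Sx ∈ H.distSet, _
    rw [h]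
  rw [dim, dim, this]

end Pattern

/-- **Iterated edge removal (degrees of freedom of latent hierarchical structures).**
Let `S 0, …, S (p-1)` be pairwise disjoint sets of latent indices, each of size at least `2`,
such that the latent variables in each `S i` have the same set of parents and the same set of
children, with common number of children at least `|S i|`, and sorted in reversed causal
order (for `i₁ < i₂`, no index in `S i₁` is an ancestor of any index in `S i₂`, where `j` is
an ancestor of `i` iff `(C_G ^ l) i j ≠ 0` for some `l ≥ 1`). Then there is a pattern
`G̃ ≤ G` with `|G̃| = |G| − Σᵢ |S i|(|S i|−1)/2` and `M(G̃) = M(G)`; consequently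
`dim(G) ≤ |G| + m − Σᵢ |S i|(|S i|−1)/2`. -/
theorem iterated_edge_removal {m n p : ℕ} (G : Pattern m n) (S : Fin p → Finset (Fin n))
    (hdisj : ∀ i₁ i₂ : Fin p, i₁ ≠ i₂ → Disjoint (S i₁) (S i₂))
    (hcard : ∀ i : Fin p, 2 ≤ (S i).card)
    (hBcols : ∀ i : Fin p, ∀ j₁ ∈ S i, ∀ j₂ ∈ S i, ∀ r : Fin m, G.B r j₁ = G.B r j₂)
    (hCcols : ∀ i : Fin p, ∀ j₁ ∈ S i, ∀ j₂ ∈ S i, ∀ r : Fin n, G.C r j₁ = G.C r j₂)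
    (hCrows : ∀ i : Fin p, ∀ j₁ ∈ S i, ∀ j₂ ∈ S i, ∀ r : Fin n, G.C j₁ r = G.C j₂ r)
    (hchild : ∀ i : Fin p, ∀ j ∈ S i, (S i).card ≤ G.childCount j)
    (horder : ∀ i₁ i₂ : Fin p, i₁ < i₂ → ∀ j ∈ S i₁, ∀ i ∈ S i₂,
      ∀ l : ℕ, 1 ≤ l → (G.C ^ l) i j = 0) :
    (∃ Gt : Pattern m n,
      (∀ i j, Gt.B i j ≤ G.B i j) ∧ (∀ i j, Gt.C i j ≤ G.C i j) ∧
      Gt.edges = G.edges - ∑ i : Fin p, (S i).card * ((S i).card - 1) / 2 ∧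
      Gt.distSet = G.distSet) ∧
    G.dim ≤ ((G.edges + m - ∑ i : Fin p, (S i).card * ((S i).card - 1) / 2 : ℕ) :
      WithBot ℕ∞) := by
  obtain ⟨Gt, hB, hC, -, hedges, hdist⟩ := G.exists_iterated_removal S hdisj
    (fun i => Finset.card_pos.1 (by have := hcard i; lia)) hBcols hCcols hCrows hchild
    fun i₁ i₂ h j hj i hi => by simpa using horder i₁ i₂ h j hj i hi 1 le_rfl
  refine ⟨⟨Gt, hB, hC, by lia, hdist⟩, ?_⟩
  rw [← Pattern.dim_eq_of_distSet_eq hdist,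
    show G.edges + m - ∑ i : Fin p, (S i).card * ((S i).card - 1) / 2 = Gt.edges + m by lia]
  exact Gt.dim_le

end
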